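/- Let X be a connected uniformly locally finite graph and n a natural number. If X has at least n+1 ends, then there exist f_1, …, f_n ∈ Z^suf_1(X,ℤ) whose images in the quotient Z^suf_1(X,ℤ)/𝒞_∞(X,ℤ) are linearly independent over ℤ. In particular, the dimension of the first uniformly finite homology H^uf_1(X,ℤ) is at least the number of ends of X minus 1. -/

import Mathlib

open scoped Classical

namespace UFH

variable {V : Type}

/-- Uniform local finiteness: a uniform bound on vertex degrees. -/
def ULF (G : SimpleGraph V) : Prop :=
  ∃ D : ℕ, ∀ v : V, (G.neighborSet v).Finite ∧ (G.neighborSet v).ncard ≤ D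

/-- An integer 1-chain: antisymmetric and supported on adjacent pairs. -/
def IsChain1 (G : SimpleGraph V) (f : V → V → ℤ) : Prop :=
  (∀ u v, f u v = - f v u) ∧ ∀ u v, f u v ≠ 0 → G.Adj u v

/-- A mod-2 1-chain: symmetric and supported on adjacent pairs. -/
def IsChain1Z2 (G : SimpleGraph V) (f : V → V → ZMod 2) : Prop :=
  (∀ u v, f u v = f v u) ∧ ∀ u v, f u v ≠ 0 → G.Adj u v

/-- Divergence of an integer 1-chain at a vertex. -/
noncomputable def chainDiv (f : V → V → ℤ) (v : V) : ℤ := ∑ᶠ u, f u v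

/-- Divergence of a mod-2 1-chain at a vertex. -/
noncomputable def chainDivZ2 (f : V → V → ZMod 2) (v : V) : ZMod 2 := ∑ᶠ u, f u v

def Bdd (f : V → V → ℤ) (C : ℕ) : Prop := ∀ u v, |f u v| ≤ (C : ℤ)

/-- The sup-norm of a bounded integer 1-chain (least uniform bound). -/
noncomputable def chainNorm (f : V → V → ℤ) : ℕ := sInf {C : ℕ | Bdd f C}

/-- Bounded integer flows: bounded 1-chains with vanishing divergence everywhere. -/
def Zsuf1 (G : SimpleGraph V) : Set (V → V → ℤ) :=
  {f | IsChain1 G f ∧ (∃ C, Bdd f C) ∧ ∀ v, chainDiv f v = 0}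

/-- Mod-2 cycles: mod-2 1-chains whose support meets every vertex evenly. -/
def Zsuf1Z2 (G : SimpleGraph V) : Set (V → V → ZMod 2) :=
  {f | IsChain1Z2 G f ∧ ∀ v, chainDivZ2 f v = 0}

/-- A circuit: a closed walk (based at some vertex). -/
abbrev Circuit (G : SimpleGraph V) := Σ v : V, G.Walk v v

/-- Number of traversals of the oriented edge `(a, b)` by the walk `p`. -/
noncomputable def traversals {G : SimpleGraph V} {u v : V} (p : G.Walk u v) (a b : V) : ℕ :=
  ((Finset.range p.length).filter fun i => p.getVert i = a ∧ p.getVert (i + 1) = b).card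

/-- The integer 1-chain of signed traversals of a walk. -/
noncomputable def walkChain {G : SimpleGraph V} {u v : V} (p : G.Walk u v) (a b : V) : ℤ :=
  (traversals p a b : ℤ) - (traversals p b a : ℤ)

/-- The mod-2 1-chain of traversals of a walk. -/
noncomputable def walkChainZ2 {G : SimpleGraph V} {u v : V} (p : G.Walk u v) (a b : V) : ZMod 2 :=
  (traversals p a b : ZMod 2) + (traversals p b a : ZMod 2)

/-- The walk `p` passes through the edge `{a, b}`. -/
def OnWalk {G : SimpleGraph V} {u v : V} (p : G.Walk u v) (a b : V) : Prop :=
  ∃ i < p.length, (p.getVert i = a ∧ p.getVert (i + 1) = b) ∨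
    (p.getVert i = b ∧ p.getVert (i + 1) = a)

/-- A coefficient family on circuits is thin (locally finite). -/
def ThinCoef (G : SimpleGraph V) (g : Circuit G → ℤ) : Prop :=
  ∀ a b : V, {c : Circuit G | g c ≠ 0 ∧ OnWalk c.2 a b}.Finite

def ThinCoefZ2 (G : SimpleGraph V) (g : Circuit G → ZMod 2) : Prop :=
  ∀ a b : V, {c : Circuit G | g c ≠ 0 ∧ OnWalk c.2 a b}.Finite

/-- The 1-chain obtained as the (pointwise) sum of a family of circuits with coefficients. -/
noncomputable def circSum (G : SimpleGraph V) (g : Circuit G → ℤ) : V → V → ℤ :=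
  fun a b => ∑ᶠ c : Circuit G, g c * walkChain c.2 a b

noncomputable def circSumZ2 (G : SimpleGraph V) (g : Circuit G → ZMod 2) : V → V → ZMod 2 :=
  fun a b => ∑ᶠ c : Circuit G, g c * walkChainZ2 c.2 a b

/-- 𝒞_r(X, ℤ): sums of circuits of length ≤ r with uniformly bounded integer coefficients. -/
def Cr (G : SimpleGraph V) (r : ℕ) : Set (V → V → ℤ) :=
  {f | ∃ g : Circuit G → ℤ, (∃ C : ℕ, ∀ c, |g c| ≤ (C : ℤ)) ∧
    (∀ c, g c ≠ 0 → c.2.length ≤ r) ∧ ThinCoef G g ∧ f = circSum G g}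

/-- 𝒞_∞(X, ℤ). -/
def Cinf (G : SimpleGraph V) : Set (V → V → ℤ) := ⋃ r : ℕ, Cr G r

/-- 𝒞(X, ℤ): thin sums of circuits with integer coefficients whose result is bounded. -/
def Cthin (G : SimpleGraph V) : Set (V → V → ℤ) :=
  {f | ∃ g : Circuit G → ℤ, ThinCoef G g ∧ (∃ C, Bdd f C) ∧ f = circSum G g}

/-- 𝒞_r(X, ℤ₂). -/
def CrZ2 (G : SimpleGraph V) (r : ℕ) : Set (V → V → ZMod 2) :=
  {f | ∃ g : Circuit G → ZMod 2, (∀ c, g c ≠ 0 → c.2.length ≤ r) ∧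
    ThinCoefZ2 G g ∧ f = circSumZ2 G g}

/-- 𝒞_∞(X, ℤ₂). -/
def CinfZ2 (G : SimpleGraph V) : Set (V → V → ZMod 2) := ⋃ r : ℕ, CrZ2 G r

/-- 𝒞(X, ℤ₂): thin sums of circuits mod 2. -/
def CthinZ2 (G : SimpleGraph V) : Set (V → V → ZMod 2) :=
  {f | ∃ g : Circuit G → ZMod 2, ThinCoefZ2 G g ∧ f = circSumZ2 G g}

/-- `a` and `b` are joined by a walk avoiding the set `K`. -/
def ConnAvoiding (G : SimpleGraph V) (K : Set V) (a b : V) : Prop :=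
  ∃ p : G.Walk a b, ∀ v ∈ p.support, v ∉ K

/-- A (one-sided infinite) ray in `G`. -/
def IsRay (G : SimpleGraph V) (x : ℕ → V) : Prop :=
  Function.Injective x ∧ ∀ n, G.Adj (x n) (x (n + 1))

/-- Two rays determine the same end. -/
def RayEquiv (G : SimpleGraph V) (x y : ℕ → V) : Prop :=
  ∀ K : Finset V, ∃ N, ∀ n, N ≤ n → ∀ m, N ≤ m → ConnAvoiding G (↑K) (x n) (y m)

/-- The connected component of `v` in `X − K`. -/
def Component (G : SimpleGraph V) (K : Set V) (v : V) : Set V :=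
  {u | u ∉ K ∧ ConnAvoiding G K u v}

def MoreThanOneEnd (G : SimpleGraph V) : Prop :=
  ∃ K : Finset V, ∃ v w : V, v ∉ K ∧ w ∉ K ∧ (Component G (↑K) v).Infinite ∧
    (Component G (↑K) w).Infinite ∧ ¬ ConnAvoiding G (↑K) v w

def OneEnded (G : SimpleGraph V) : Prop :=
  Infinite V ∧ ∀ K : Finset V, ∃ v, v ∉ K ∧ (Component G (↑K) v).Infinite ∧
    ∀ u, u ∉ K → (Component G (↑K) u).Infinite → ConnAvoiding G (↑K) u v

/-- A bip: a bi-infinite path, i.e. injective graph morphism ℤ → T. -/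
def IsBip (T : SimpleGraph V) (b : ℤ → V) : Prop :=
  Function.Injective b ∧ ∀ n : ℤ, T.Adj (b n) (b (n + 1))

/-- The bip `b` lies over the edge `{u, v}`. -/
def LiesOver (b : ℤ → V) (u v : V) : Prop :=
  ∃ n : ℤ, (b n = u ∧ b (n + 1) = v) ∨ (b n = v ∧ b (n + 1) = u)

/-- The signed traversal of the oriented edge `(u, v)` by the bip `b`. -/
noncomputable def bipSign (b : ℤ → V) (u v : V) : ℤ :=
  if ∃ n : ℤ, b n = u ∧ b (n + 1) = v then 1
  else if ∃ n : ℤ, b n = v ∧ b (n + 1) = u then -1 else 0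

noncomputable def bipOverZ2 (b : ℤ → V) (u v : V) : ZMod 2 :=
  if LiesOver b u v then 1 else 0

/-- `p` is the last bip of `P` (w.r.t. the order `r`) lying over the edge `{u, v}`. -/
def IsLast (P : Set (ℤ → V)) (r : (ℤ → V) → (ℤ → V) → Prop) (p : ℤ → V) (u v : V) : Prop :=
  LiesOver p u v ∧ ∀ q ∈ P, q ≠ p → LiesOver q u v → r q p

/-- The 1-chain associated to coefficients on a family of bips. -/
noncomputable def bipMap (P : Set (ℤ → V)) (f : ↥P → ℤ) : V → V → ℤ :=
  fun u v => ∑ᶠ p : ↥P, f p * bipSign p.1 u v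

noncomputable def bipMapZ2 (P : Set (ℤ → V)) (f : ↥P → ZMod 2) : V → V → ZMod 2 :=
  fun u v => ∑ᶠ p : ↥P, f p * bipOverZ2 p.1 u v

/-- The set `S` is connected in the graph `H` (walks staying inside `S`). -/
def ConnectedIn (H : SimpleGraph V) (S : Set V) : Prop :=
  ∀ a ∈ S, ∀ b ∈ S, ∃ p : H.Walk a b, ∀ v ∈ p.support, v ∈ S

/-- `T` is a subtree of `G`. -/
def IsSubtree (G T : SimpleGraph V) : Prop :=
  T ≤ G ∧ T.IsAcyclic ∧ T.support.Nonempty ∧ ConnectedIn T T.support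

/-- Every vertex of `T` has degree ≥ 2 in `T`. -/
def Leafless (T : SimpleGraph V) : Prop :=
  ∀ v ∈ T.support, ∃ u w : V, u ≠ w ∧ T.Adj v u ∧ T.Adj v w

/-- Distinct ends of `T` determine distinct ends of `G`. -/
def EndRespecting (G T : SimpleGraph V) : Prop :=
  ∀ x y : ℕ → V, IsRay T x → IsRay T y → RayEquiv G x y → RayEquiv T x y

/-- Every end of `G` is represented by a unique end of `T`. -/
def EndDefining (G T : SimpleGraph V) : Prop :=
  EndRespecting G T ∧ ∀ x : ℕ → V, IsRay G x → ∃ y : ℕ → V, IsRay T y ∧ RayEquiv G x y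

/-- The subtree `T` of `G` has separators. -/
def HasSeparators (G T : SimpleGraph V) : Prop :=
  ∃ K : ℕ → Finset V,
    (∀ n, K n ⊆ K (n + 1)) ∧
    (∀ v : V, ∃ n, v ∈ K n) ∧
    (∀ n, ConnectedIn G (↑(K n))) ∧
    (∀ n, ConnectedIn T (T.support ∩ ↑(K n))) ∧
    (∀ n, ∀ v : V, v ∉ K n → (Component G (↑(K n)) v).Infinite →
      ∃! e : V × V, T.Adj e.1 e.2 ∧ e.1 ∈ K n ∧ e.2 ∉ K n ∧
        e.2 ∈ Component G (↑(K n)) v) ∧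
    (∀ n, ∀ a b : V, T.Adj a b → a ∈ K n → b ∉ K n → (Component G (↑(K n)) b).Infinite)

/-- An integer 2-chain: alternating, supported on triangles. -/
def IsChain2 (G : SimpleGraph V) (g : V → V → V → ℤ) : Prop :=
  (∀ u v w, g u v w = - g v u w) ∧ (∀ u v w, g u v w = - g u w v) ∧
    ∀ u v w, g u v w ≠ 0 → G.Adj u v ∧ G.Adj v w ∧ G.Adj u w

def Bdd2 (g : V → V → V → ℤ) (C : ℕ) : Prop := ∀ u v w, |g u v w| ≤ (C : ℤ)

/-- The boundary of a 2-chain. -/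
noncomputable def bd2 (g : V → V → V → ℤ) : V → V → ℤ := fun u v => ∑ᶠ w, g u v w

/-- `H^suf_1`-expansion. -/
def HsufExp1 (G : SimpleGraph V) : Prop :=
  ∃ K : ℕ → ℕ, ∀ U : Finset V, ∀ f : V → V → ℤ,
    IsChain1 G f →
    (∀ u v, f u v ≠ 0 → u ∈ U ∧ v ∈ U) →
    (∀ v ∈ U, (∀ u, G.Adj u v → u ∈ U) → chainDiv f v = 0) →
    (∃ fh ∈ Zsuf1 G, (∀ u ∈ U, ∀ v ∈ U, fh u v = f u v) ∧ chainNorm fh = chainNorm f) →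
    ∃ g : V → V → V → ℤ, IsChain2 G g ∧ Bdd2 g (K (chainNorm f)) ∧
      ∀ u ∈ U, ∀ v ∈ U, bd2 g u v = f u v

/-- Pure `H^suf_1`-expansion. -/
def PureHsufExp1 (G : SimpleGraph V) : Prop :=
  ∃ K : ℕ → ℕ, ∀ U : Finset V, ∀ f : V → V → ℤ,
    IsChain1 G f →
    (∀ u v, f u v ≠ 0 → u ∈ U ∧ v ∈ U) →
    (∀ v ∈ U, (∀ u, G.Adj u v → u ∈ U) → chainDiv f v = 0) →
    (∃ fh : V → V → ℤ, IsChain1 G fh ∧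
        (∃ g2 : V → V → V → ℤ, IsChain2 G g2 ∧ (∃ C, Bdd2 g2 C) ∧ bd2 g2 = fh) ∧
        (∀ u ∈ U, ∀ v ∈ U, fh u v = f u v) ∧ chainNorm fh = chainNorm f) →
    ∃ g : V → V → V → ℤ, IsChain2 G g ∧ Bdd2 g (K (chainNorm f)) ∧
      ∀ u ∈ U, ∀ v ∈ U, bd2 g u v = f u v

/-- The Rips graph of radius `s`. -/
def rips (G : SimpleGraph V) (s : ℕ) : SimpleGraph V :=
  SimpleGraph.fromRel fun u v => G.dist u v ≤ s

/-- Pure `H^uf_1`-expansion: the Rips graphs eventually have pure `H^suf_1`-expansion. -/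
def PureHufExp1 (G : SimpleGraph V) : Prop := ∃ s₀ : ℕ, ∀ s, s₀ ≤ s → PureHsufExp1 (rips G s)

def VertexTransitive (G : SimpleGraph V) : Prop := ∀ u v : V, ∃ φ : G ≃g G, φ u = v

/-- The edge boundary of a finite set of vertices. -/
def edgeBoundary (G : SimpleGraph V) (U : Finset V) : Set (Sym2 V) :=
  {e | e ∈ G.edgeSet ∧ ∃ a b : V, e = s(a, b) ∧ a ∈ U ∧ b ∉ U}

/-- Mod-2 reduction of an integer 1-chain. -/
def mod2 (f : V → V → ℤ) : V → V → ZMod 2 := fun u v => ((f u v : ℤ) : ZMod 2)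

/-- Pointwise domination of 1-chains: `r` flows in the same direction as `φ`, no stronger. -/
def chainLE (r φ : V → V → ℤ) : Prop :=
  ∀ u v, (0 ≤ φ u v → 0 ≤ r u v ∧ r u v ≤ φ u v) ∧ (φ u v ≤ 0 → φ u v ≤ r u v ∧ r u v ≤ 0)

/-- A set of functions is locally finite (thin). -/
def ThinFamily {Y : Type} (F : Set (Y → ZMod 2)) : Prop := ∀ y : Y, {f ∈ F | f y ≠ 0}.Finite

/-- The pointwise sum of a (thin) set of functions. -/
noncomputable def thinSum {Y : Type} (F : Set (Y → ZMod 2)) : Y → ZMod 2 :=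
  fun y => ∑ᶠ f : ↥F, f.1 y

/-- A thin-sum space: a subspace closed under thin sums. -/
def IsThinSumSpace {Y : Type} (W : Set (Y → ZMod 2)) : Prop :=
  0 ∈ W ∧ (∀ f ∈ W, ∀ g ∈ W, f + g ∈ W) ∧ ∀ F ⊆ W, ThinFamily F → thinSum F ∈ W

/-- A thin-sum basis for a thin-sum space. -/
def IsThinSumBasis {Y : Type} (A W : Set (Y → ZMod 2)) : Prop :=
  A ⊆ W ∧ (∀ f ∈ W, ∃ F ⊆ A, ThinFamily F ∧ f = thinSum F) ∧
    ∀ F ⊆ A, ThinFamily F → F.Nonempty → thinSum F ≠ 0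

/-- The signed number of traversals of `(a, b)` by the first `N` steps of the sequence `x`. -/
noncomputable def seqChain (x : ℕ → V) (N : ℕ) (a b : V) : ℤ :=
  (((Finset.range N).filter fun i => x i = a ∧ x (i + 1) = b).card : ℤ) -
    (((Finset.range N).filter fun i => x i = b ∧ x (i + 1) = a).card : ℤ)

/-- The 1-chain of signed traversals of an infinite sequence visiting each edge at most once. -/
noncomputable def rayChain (x : ℕ → V) (a b : V) : ℤ :=
  (if ∃ i, x i = a ∧ x (i + 1) = b then 1 else 0) - (if ∃ i, x i = b ∧ x (i + 1) = a then 1 else 0)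

theorem walkChain_eq_seqChain {G : SimpleGraph V} {u v : V} (p : G.Walk u v) :
    walkChain p = seqChain p.getVert p.length := rfl

theorem seqChain_antisymm (x : ℕ → V) (N : ℕ) (a b : V) :
    seqChain x N a b = - seqChain x N b a := by
  simp [seqChain]

theorem rayChain_antisymm (x : ℕ → V) (a b : V) : rayChain x a b = - rayChain x b a := by
  simp [rayChain]

theorem abs_seqChain_le (x : ℕ → V) (N : ℕ) (a b : V) : |seqChain x N a b| ≤ (N : ℤ) := by
  have h (q : ℕ → Prop) [DecidablePred q] : (((Finset.range N).filter q).card : ℤ) ≤ N := by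
    exact_mod_cast (Finset.card_filter_le _ _).trans_eq (Finset.card_range N)
  rw [seqChain, abs_le]
  have h₁ := h fun i => x i = a ∧ x (i + 1) = b
  have h₂ := h fun i => x i = b ∧ x (i + 1) = a
  constructor <;> omega

theorem abs_rayChain_le (x : ℕ → V) (a b : V) : |rayChain x a b| ≤ 1 := by
  unfold rayChain
  split_ifs <;> simp

theorem exists_step_of_seqChain_ne_zero {x : ℕ → V} {N : ℕ} {a b : V}
    (h : seqChain x N a b ≠ 0) :
    ∃ i < N, (x i = a ∧ x (i + 1) = b) ∨ (x i = b ∧ x (i + 1) = a) := by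
  contrapose! h
  rw [seqChain, Finset.filter_eq_empty_iff.2, Finset.filter_eq_empty_iff.2]
  · simp
  · intro i hi hx
    exact (h i (Finset.mem_range.1 hi)).2 hx.1 hx.2
  · intro i hi hx
    exact (h i (Finset.mem_range.1 hi)).1 hx.1 hx.2

theorem exists_step_of_rayChain_ne_zero {x : ℕ → V} {a b : V} (h : rayChain x a b ≠ 0) :
    ∃ i, (x i = a ∧ x (i + 1) = b) ∨ (x i = b ∧ x (i + 1) = a) := by
  contrapose! h
  rw [rayChain, if_neg, if_neg, sub_zero]
  · rintro ⟨i, hi⟩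
    exact (h i).2 hi.1 hi.2
  · rintro ⟨i, hi⟩
    exact (h i).1 hi.1 hi.2

theorem eventually_card_filter_range_eq {q : ℕ → Prop} [DecidablePred q]
    (hq : ∀ i j, q i → q j → i = j) :
    ∀ᶠ N in Filter.atTop,
      (((Finset.range N).filter q).card : ℤ) = if ∃ i, q i then 1 else 0 := by
  by_cases h : ∃ i, q i
  · obtain ⟨i, hi⟩ := h
    filter_upwards [Filter.eventually_gt_atTop i] with N hN
    have : (Finset.range N).filter q = {i} := by
      ext j
      simp only [Finset.mem_filter, Finset.mem_range, Finset.mem_singleton]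
      exact ⟨fun hj => hq j i hj.2 hi, fun hj => hj ▸ ⟨hN, hi⟩⟩
    rw [this, if_pos ⟨i, hi⟩]
    simp
  · refine Filter.Eventually.of_forall fun N => ?_
    rw [if_neg h, Finset.filter_eq_empty_iff.2 fun i _ hi => h ⟨i, hi⟩]
    simp

theorem eventually_seqChain_eq_rayChain {x : ℕ → V} (hx : Function.Injective x) (a b : V) :
    ∀ᶠ N in Filter.atTop, seqChain x N a b = rayChain x a b := by
  filter_upwards [eventually_card_filter_range_eq (q := fun i => x i = a ∧ x (i + 1) = b)
      fun i j hi hj => hx (hi.1.trans hj.1.symm),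
    eventually_card_filter_range_eq (q := fun i => x i = b ∧ x (i + 1) = a)
      fun i j hi hj => hx (hi.1.trans hj.1.symm)] with N h₁ h₂
  rw [seqChain, rayChain, h₁, h₂]

/-- `B` is the set of oriented edges of `G` that enter `S`. -/
def IsInBoundary (G : SimpleGraph V) (S : Set V) (B : Finset (V × V)) : Prop :=
  ∀ a b, (a, b) ∈ B ↔ G.Adj a b ∧ a ∉ S ∧ b ∈ S

section Flux

variable {G : SimpleGraph V} {S : Set V} {B : Finset (V × V)}

theorem IsInBoundary.sum_seqChain (hB : IsInBoundary G S B) {x : ℕ → V} {N : ℕ}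
    (hx : ∀ i < N, G.Adj (x i) (x (i + 1))) :
    ∑ e ∈ B, seqChain x N e.1 e.2 =
      (if x N ∈ S then 1 else 0) - (if x 0 ∈ S then 1 else 0) := by
  have key (i : ℕ) (hi : i < N) :
      ∑ e ∈ B, ((if x i = e.1 ∧ x (i + 1) = e.2 then (1 : ℤ) else 0) -
        (if x i = e.2 ∧ x (i + 1) = e.1 then 1 else 0)) =
      (if x (i + 1) ∈ S then 1 else 0) - (if x i ∈ S then 1 else 0) := by
    have h₁ : ∀ e : V × V, (x i = e.1 ∧ x (i + 1) = e.2) ↔ (x i, x (i + 1)) = e := by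
      simp [Prod.ext_iff]
    have h₂ : ∀ e : V × V, (x i = e.2 ∧ x (i + 1) = e.1) ↔ (x (i + 1), x i) = e := by
      simp [Prod.ext_iff, and_comm]
    simp only [h₁, h₂, Finset.sum_sub_distrib, Finset.sum_ite_eq, hB _ _, hx i hi,
      (hx i hi).symm, true_and]
    by_cases h : x i ∈ S <;> by_cases h' : x (i + 1) ∈ S <;> simp [h, h']
  simp only [seqChain, Finset.card_filter, Nat.cast_sum, Nat.cast_ite, Nat.cast_one,
    Nat.cast_zero, ← Finset.sum_sub_distrib]
  rw [Finset.sum_comm, Finset.sum_congr rfl fun i hi => key i (Finset.mem_range.1 hi)]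
  exact Finset.sum_range_sub (fun i => if x i ∈ S then (1 : ℤ) else 0) N

theorem IsInBoundary.sum_walkChain (hB : IsInBoundary G S B) {u v : V} (p : G.Walk u v) :
    ∑ e ∈ B, walkChain p e.1 e.2 = (if v ∈ S then 1 else 0) - (if u ∈ S then 1 else 0) := by
  have h := hB.sum_seqChain (x := p.getVert) fun i hi => p.adj_getVert_succ hi
  rwa [p.getVert_length, p.getVert_zero] at h

theorem IsInBoundary.sum_rayChain (hB : IsInBoundary G S B) {x : ℕ → V} (hx : IsRay G x)
    {P : Prop} (hP : ∀ᶠ i in Filter.atTop, x i ∈ S ↔ P) :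
    ∑ e ∈ B, rayChain x e.1 e.2 = (if P then 1 else 0) - (if x 0 ∈ S then 1 else 0) := by
  have h : ∀ᶠ N in Filter.atTop, ∀ e ∈ B, seqChain x N e.1 e.2 = rayChain x e.1 e.2 :=
    (Filter.eventually_all_finset B).2 fun e _ => eventually_seqChain_eq_rayChain hx.1 e.1 e.2
  obtain ⟨N, hN, hNP⟩ := (h.and hP).exists
  rw [← Finset.sum_congr rfl hN, hB.sum_seqChain fun i _ => hx.2 i]
  simp only [hNP]

theorem IsInBoundary.sum_circSum (hB : IsInBoundary G S B) {g : Circuit G → ℤ}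
    (hg : ThinCoef G g) : ∑ e ∈ B, circSum G g e.1 e.2 = 0 := by
  have hfin : (⋃ e ∈ B, {c : Circuit G | g c ≠ 0 ∧ OnWalk c.2 e.1 e.2}).Finite :=
    B.finite_toSet.biUnion fun e _ => hg e.1 e.2
  have h (e) (he : e ∈ B) :
      circSum G g e.1 e.2 = ∑ c ∈ hfin.toFinset, g c * walkChain c.2 e.1 e.2 := by
    refine finsum_eq_sum_of_support_subset _ fun c hc => ?_
    rw [Function.mem_support, mul_ne_zero_iff] at hc
    simp only [Set.Finite.coe_toFinset, Set.mem_iUnion]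
    exact ⟨e, he, hc.1, exists_step_of_seqChain_ne_zero hc.2⟩
  rw [Finset.sum_congr rfl h, Finset.sum_comm]
  refine Finset.sum_eq_zero fun c _ => ?_
  rw [← Finset.mul_sum, hB.sum_walkChain, sub_self, mul_zero]

end Flux

theorem exists_isInBoundary_singleton {G : SimpleGraph V} {v : V}
    (hv : (G.neighborSet v).Finite) :
    ∃ B, IsInBoundary G {v} B ∧ ∀ f, IsChain1 G f → chainDiv f v = ∑ e ∈ B, f e.1 e.2 := by
  refine ⟨hv.toFinset ×ˢ {v}, fun a b => ?_, fun f hf => ?_⟩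
  · simp only [Finset.mem_product, Set.Finite.mem_toFinset, SimpleGraph.mem_neighborSet,
      Finset.mem_singleton, Set.mem_singleton_iff]
    constructor
    · rintro ⟨h, rfl⟩
      exact ⟨h.symm, h.ne', rfl⟩
    · rintro ⟨h, -, rfl⟩
      exact ⟨h.symm, rfl⟩
  · rw [Finset.sum_product]
    simp only [Finset.sum_singleton]
    refine finsum_eq_sum_of_support_subset _ fun u hu => ?_
    simpa using (hf.2 u v hu).symm

theorem connAvoiding_symm {G : SimpleGraph V} {K : Set V} {a b : V} (h : ConnAvoiding G K a b) :
    ConnAvoiding G K b a := by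
  obtain ⟨p, hp⟩ := h
  exact ⟨p.reverse, by simpa using hp⟩

theorem connAvoiding_trans {G : SimpleGraph V} {K : Set V} {a b c : V}
    (h : ConnAvoiding G K a b) (h' : ConnAvoiding G K b c) : ConnAvoiding G K a c := by
  obtain ⟨p, hp⟩ := h
  obtain ⟨q, hq⟩ := h'
  refine ⟨p.append q, fun v hv => ?_⟩
  exact ((SimpleGraph.Walk.mem_support_append_iff p q).1 hv).elim (hp v) (hq v)

theorem connAvoiding_of_adj {G : SimpleGraph V} {K : Set V} {a b : V} (h : G.Adj a b)
    (ha : a ∉ K) (hb : b ∉ K) : ConnAvoiding G K a b :=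
  ⟨h.toWalk, by simp [SimpleGraph.Adj.toWalk, ha, hb]⟩

theorem connAvoiding_mono {G : SimpleGraph V} {K L : Set V} (hKL : K ⊆ L) {a b : V}
    (h : ConnAvoiding G L a b) : ConnAvoiding G K a b :=
  h.imp fun _ hp v hv hK => hp v hv (hKL hK)

theorem exists_isInBoundary_component {G : SimpleGraph V}
    (hG : ∀ v, (G.neighborSet v).Finite) (K : Finset V) (v : V) :
    ∃ B, IsInBoundary G (Component G (↑K) v) B := by
  have hfin : {e : V × V | G.Adj e.1 e.2 ∧ e.1 ∉ Component G (↑K) v ∧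
      e.2 ∈ Component G (↑K) v}.Finite := by
    refine (K.finite_toSet.biUnion fun k _ => (Set.finite_singleton k).prod (hG k)).subset ?_
    rintro ⟨a, b⟩ ⟨hab, ha, hb⟩
    have haK : a ∈ K := by
      by_contra haK
      exact ha ⟨haK, connAvoiding_trans (connAvoiding_of_adj hab haK hb.1) hb.2⟩
    simp only [Set.mem_iUnion]
    exact ⟨a, haK, rfl, hab⟩
  exact ⟨hfin.toFinset, fun a b => by simp⟩

theorem connAvoiding_ray_tail {G : SimpleGraph V} {K : Set V} {x : ℕ → V} (hx : IsRay G x)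
    {N : ℕ} (hN : ∀ n, N ≤ n → x n ∉ K) {n : ℕ} (hn : N ≤ n) : ConnAvoiding G K (x n) (x N) := by
  induction n, hn using Nat.le_induction with
  | base => exact ⟨.nil, by simpa using hN N le_rfl⟩
  | succ n hn ih =>
    exact connAvoiding_trans
      (connAvoiding_of_adj (hx.2 n).symm (hN _ (Nat.le_succ_of_le hn)) (hN n hn)) ih

/-- Finitely many pairwise inequivalent rays have tails separated by a finite set. -/
theorem exists_separating_finset {G : SimpleGraph V} {ι : Type*} [Fintype ι] {R : ι → ℕ → V}
    (hR : ∀ i, IsRay G (R i)) (hne : ∀ i j, i ≠ j → ¬ RayEquiv G (R i) (R j)) :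
    ∃ (K : Finset V) (N : ℕ), ∀ i j, ∀ n, N ≤ n →
      (R i n ∈ Component G (↑K) (R j N) ↔ i = j) := by
  have hsep (i j : ι) : ∃ K : Finset V, i ≠ j → ∀ N, ∃ n, N ≤ n ∧ ∃ m, N ≤ m ∧
      ¬ ConnAvoiding G (↑K) (R i n) (R j m) := by
    by_cases hij : i = j
    · exact ⟨∅, fun h => absurd hij h⟩
    · have := hne i j hij
      simp only [RayEquiv] at this
      push Not at this
      exact this.imp fun K hK _ => hK
  choose L hL using hsep
  let K : Finset V := Finset.univ.biUnion fun i => Finset.univ.biUnion fun j => L i j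
  have hLK (i j) : (L i j : Set V) ⊆ K := fun v hv => by
    simp only [K, Finset.coe_biUnion, Set.mem_iUnion]
    exact ⟨i, Finset.mem_coe.2 (Finset.mem_univ i), j, Finset.mem_coe.2 (Finset.mem_univ j), hv⟩
  have havoid : ∀ᶠ n in Filter.atTop, ∀ i, R i n ∉ K := by
    refine Filter.eventually_all.2 fun i => ?_
    have := (hR i).1.tendsto_cofinite.eventually K.finite_toSet.compl_mem_cofinite
    rwa [Nat.cofinite_eq_atTop] at this
  obtain ⟨N, hN⟩ := Filter.eventually_atTop.1 havoid
  have htail (i n) (hn : N ≤ n) : ConnAvoiding G (↑K) (R i n) (R i N) :=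
    connAvoiding_ray_tail (hR i) (fun n hn => hN n hn i) hn
  refine ⟨K, N, fun i j n hn => ⟨fun h => ?_, ?_⟩⟩
  · by_contra hij
    obtain ⟨n', hn', m', hm', hnot⟩ := hL i j hij N
    refine hnot (connAvoiding_mono (hLK i j) ?_)
    exact connAvoiding_trans (htail i n' hn') (connAvoiding_trans
      (connAvoiding_symm (htail i n hn)) (connAvoiding_trans h.2
        (connAvoiding_symm (htail j m' hm'))))
  · rintro rfl
    exact ⟨hN n hn i, htail i n hn⟩

/-- The flow coming in along the ray `x`, then following `p`, then going out along `y`. -/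
noncomputable def doubleRayChain {G : SimpleGraph V} (x y : ℕ → V) (p : G.Walk (x 0) (y 0)) :
    V → V → ℤ :=
  fun a b => rayChain y a b - rayChain x a b + walkChain p a b

section DoubleRay

variable {G : SimpleGraph V} {x y : ℕ → V}

theorem IsInBoundary.sum_doubleRayChain {S : Set V} {B : Finset (V × V)}
    (hB : IsInBoundary G S B) (hx : IsRay G x) (hy : IsRay G y) (p : G.Walk (x 0) (y 0))
    {P Q : Prop} (hP : ∀ᶠ i in Filter.atTop, x i ∈ S ↔ P)
    (hQ : ∀ᶠ i in Filter.atTop, y i ∈ S ↔ Q) :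
    ∑ e ∈ B, doubleRayChain x y p e.1 e.2 = (if Q then 1 else 0) - (if P then 1 else 0) := by
  simp only [doubleRayChain, Finset.sum_add_distrib, Finset.sum_sub_distrib,
    hB.sum_rayChain hx hP, hB.sum_rayChain hy hQ, hB.sum_walkChain p]
  ring

theorem isChain1_doubleRayChain (hx : IsRay G x) (hy : IsRay G y) (p : G.Walk (x 0) (y 0)) :
    IsChain1 G (doubleRayChain x y p) := by
  refine ⟨fun a b => ?_, fun a b hab => ?_⟩
  · simp only [doubleRayChain, walkChain_eq_seqChain]
    rw [rayChain_antisymm x a b, rayChain_antisymm y a b, seqChain_antisymm _ _ a b]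
    ring
  · have hray {z : ℕ → V} (hz : IsRay G z) (h : ¬ G.Adj a b) : rayChain z a b = 0 := by
      by_contra h0
      obtain ⟨i, ⟨rfl, rfl⟩ | ⟨rfl, rfl⟩⟩ := exists_step_of_rayChain_ne_zero h0
      exacts [h (hz.2 i), h (hz.2 i).symm]
    have hwalk (h : ¬ G.Adj a b) : walkChain p a b = 0 := by
      by_contra h0
      obtain ⟨i, hi, ⟨rfl, rfl⟩ | ⟨rfl, rfl⟩⟩ := exists_step_of_seqChain_ne_zero h0
      exacts [h (p.adj_getVert_succ hi), h (p.adj_getVert_succ hi).symm]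
    by_contra h
    exact hab (by simp [doubleRayChain, hray hx h, hray hy h, hwalk h])

theorem doubleRayChain_mem_Zsuf1 (hG : ∀ v, (G.neighborSet v).Finite) (hx : IsRay G x)
    (hy : IsRay G y) (p : G.Walk (x 0) (y 0)) : doubleRayChain x y p ∈ Zsuf1 G := by
  have hchain := isChain1_doubleRayChain hx hy p
  refine ⟨hchain, ⟨2 + p.length, fun a b => ?_⟩, fun v => ?_⟩
  · have h₁ := abs_le.1 (abs_rayChain_le x a b)
    have h₂ := abs_le.1 (abs_rayChain_le y a b)
    have h₃ := abs_le.1 (abs_seqChain_le p.getVert p.length a b)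
    rw [← walkChain_eq_seqChain] at h₃
    rw [doubleRayChain, abs_le]
    push_cast
    constructor <;> linarith
  · obtain ⟨B, hB, hdiv⟩ := exists_isInBoundary_singleton (hG v)
    have hev {z : ℕ → V} (hz : IsRay G z) :
        ∀ᶠ i in Filter.atTop, z i ∈ ({v} : Set V) ↔ False := by
      have := hz.1.tendsto_cofinite.eventually (Set.finite_singleton v).compl_mem_cofinite
      rw [Nat.cofinite_eq_atTop] at this
      exact this.mono fun i hi => iff_false_intro hi
    rw [hdiv _ hchain, hB.sum_doubleRayChain hx hy p (hev hx) (hev hy), sub_self]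

end DoubleRay

/-- at least n+1 ends give n independent classes in H^uf_1(X, ℤ). -/
theorem stmt6 (G : SimpleGraph V) (hulf : ULF G) (hconn : G.Connected) (n : ℕ)
    (hends : ∃ R : Fin (n + 1) → ℕ → V, (∀ i, IsRay G (R i)) ∧
      ∀ i j, i ≠ j → ¬ RayEquiv G (R i) (R j)) :
    ∃ f : Fin n → (V → V → ℤ), (∀ i, f i ∈ Zsuf1 G) ∧
      ∀ a : Fin n → ℤ, (∑ i, a i • f i) ∈ Cinf G → ∀ i, a i = 0 := by
  obtain ⟨D, hD⟩ := hulf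
  have hG (v) : (G.neighborSet v).Finite := (hD v).1
  obtain ⟨R, hR, hne⟩ := hends
  have hwalk (i : Fin n) : Nonempty (G.Walk (R 0 0) (R i.succ 0)) := hconn.preconnected _ _
  let p (i : Fin n) : G.Walk (R 0 0) (R i.succ 0) := (hwalk i).some
  refine ⟨fun i => doubleRayChain (R 0) (R i.succ) (p i),
    fun i => doubleRayChain_mem_Zsuf1 hG (hR _) (hR _) _, fun a ha j => ?_⟩
  obtain ⟨r, g, -, -, hthin, hg⟩ := Set.mem_iUnion.1 ha
  obtain ⟨K, N, hK⟩ := exists_separating_finset hR hne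
  obtain ⟨B, hB⟩ := exists_isInBoundary_component hG K (R j.succ N)
  have hflux (i : Fin n) : ∑ e ∈ B, doubleRayChain (R 0) (R i.succ) (p i) e.1 e.2 =
      if i = j then 1 else 0 := by
    have hev (k) := Filter.eventually_atTop.2 ⟨N, hK k j.succ⟩
    rw [hB.sum_doubleRayChain (hR _) (hR _) _ (hev 0) (hev i.succ)]
    simp [(Fin.succ_ne_zero j).symm]
  have hzero := hB.sum_circSum hthin
  rw [← hg] at hzero
  simp only [Finset.sum_apply, Pi.smul_apply, smul_eq_mul] at hzero
  rw [Finset.sum_comm] at hzero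
  simpa [← Finset.mul_sum, hflux] using hzero

end UFH
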